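/- arXiv:2302.07064 — 6 statements merged into one kernel-verified Lean document; each statement's English description precedes it below -/
import Mathlib

section
/- Let δ > 0 and define τ_δ : ℝ → ℝ by τ_δ(ξ) = (ξ/δ)·tanh(δξ). Then for every ξ ≠ 0, the function ξ ↦ √(τ_δ(ξ)) is twice differentiable at ξ, its second derivative equals −(1/τ_δ(ξ)^{3/2}) · [ (sinh(δξ)·cosh(δξ) − δξ)² + 4δ²ξ²·sinh²(δξ) ] / (4δ²·cosh⁴(δξ)), and in particular this second derivative is strictly negative. -/
lemma aux_pos (δ : ℝ) (hδ : 0 < δ) (x : ℝ) (hx : x ≠ 0) :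
    0 < (x / δ) * Real.tanh (δ * x) := by
  rw [Real.tanh_eq_sinh_div_cosh]
  have hc := Real.cosh_pos (δ * x)
  rcases lt_or_gt_of_ne hx with h | h
  · have h1 : Real.sinh (δ * x) < 0 := Real.sinh_neg_iff.2 (mul_neg_of_pos_of_neg hδ h)
    exact mul_pos_of_neg_of_neg (div_neg_of_neg_of_pos h hδ) (div_neg_of_neg_of_pos h1 hc)
  · have h1 : 0 < Real.sinh (δ * x) := Real.sinh_pos_iff.2 (mul_pos hδ h)
    positivity

lemma aux_d1 (δ : ℝ) (hδ : 0 < δ) (x : ℝ) :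
    HasDerivAt (fun x : ℝ => (x / δ) * Real.tanh (δ * x))
      ((Real.sinh (δ * x) * Real.cosh (δ * x) + δ * x) / (δ * Real.cosh (δ * x) ^ 2)) x := by
  have hc := (Real.cosh_pos (δ * x)).ne'
  have hl : HasDerivAt (fun x : ℝ => δ * x) δ x := by
    simpa using (hasDerivAt_id x).const_mul δ
  have h := ((hasDerivAt_id x).div_const δ).mul (hl.sinh.div hl.cosh hc)
  have e : (fun x : ℝ => (x / δ) * Real.tanh (δ * x)) =
      (fun x : ℝ => (x / δ) * (Real.sinh (δ * x) / Real.cosh (δ * x))) := by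
    funext y; rw [Real.tanh_eq_sinh_div_cosh]
  rw [e]
  refine HasDerivAt.congr_deriv h ?_
  have hs := Real.cosh_sq (δ * x)
  simp only [id, Pi.div_apply]
  field_simp
  linear_combination (δ * x) * hs

lemma aux_d2 (δ : ℝ) (hδ : 0 < δ) (x : ℝ) :
    HasDerivAt (fun x : ℝ =>
      (Real.sinh (δ * x) * Real.cosh (δ * x) + δ * x) / (δ * Real.cosh (δ * x) ^ 2))
      (2 * (Real.cosh (δ * x) - δ * x * Real.sinh (δ * x)) / Real.cosh (δ * x) ^ 3) x := by
  have hc := (Real.cosh_pos (δ * x)).ne'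
  have hl : HasDerivAt (fun x : ℝ => δ * x) δ x := by
    simpa using (hasDerivAt_id x).const_mul δ
  have h := ((hl.sinh.mul hl.cosh).add hl).div ((hl.cosh.pow 2).const_mul δ)
    (by simp only [Pi.pow_apply]; positivity)
  refine HasDerivAt.congr_deriv h ?_
  have hs := Real.cosh_sq (δ * x)
  simp only [Pi.mul_apply, Pi.add_apply, Pi.pow_apply]
  field_simp
  generalize Real.cosh (δ * x) = c at *
  generalize Real.sinh (δ * x) = s at *
  push_cast
  linear_combination (c ^ 2) * hs

/-- For `δ > 0`, `τ_δ(ξ) = (ξ/δ)·tanh(δξ)` and every `ξ ≠ 0`, the function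
`ξ ↦ √(τ_δ(ξ))` is twice differentiable at `ξ`, its second derivative equals
`−(1/τ_δ(ξ)^{3/2}) · [(sinh(δξ)cosh(δξ) − δξ)² + 4δ²ξ² sinh²(δξ)] / (4δ² cosh⁴(δξ))`,
and this second derivative is strictly negative. -/
theorem second_deriv_sqrt_tau (δ : ℝ) (hδ : 0 < δ) (ξ : ℝ) (hξ : ξ ≠ 0) :
    DifferentiableAt ℝ (fun x : ℝ => Real.sqrt ((x / δ) * Real.tanh (δ * x))) ξ ∧
    HasDerivAt (deriv (fun x : ℝ => Real.sqrt ((x / δ) * Real.tanh (δ * x))))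
      (-(1 / ((ξ / δ) * Real.tanh (δ * ξ)) ^ ((3 : ℝ) / 2)) *
        (((Real.sinh (δ * ξ) * Real.cosh (δ * ξ) - δ * ξ) ^ 2 +
            4 * δ ^ 2 * ξ ^ 2 * Real.sinh (δ * ξ) ^ 2) /
          (4 * δ ^ 2 * Real.cosh (δ * ξ) ^ 4))) ξ ∧
    -(1 / ((ξ / δ) * Real.tanh (δ * ξ)) ^ ((3 : ℝ) / 2)) *
        (((Real.sinh (δ * ξ) * Real.cosh (δ * ξ) - δ * ξ) ^ 2 +
            4 * δ ^ 2 * ξ ^ 2 * Real.sinh (δ * ξ) ^ 2) /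
          (4 * δ ^ 2 * Real.cosh (δ * ξ) ^ 4)) < 0 := by
  have hpos := aux_pos δ hδ ξ hξ
  have hc := Real.cosh_pos (δ * ξ)
  have hsq := Real.sqrt_pos.2 hpos
  have hD : ∀ x : ℝ, x ≠ 0 →
      HasDerivAt (fun x : ℝ => Real.sqrt ((x / δ) * Real.tanh (δ * x)))
      ((Real.sinh (δ * x) * Real.cosh (δ * x) + δ * x) / (δ * Real.cosh (δ * x) ^ 2) /
        (2 * Real.sqrt ((x / δ) * Real.tanh (δ * x)))) x :=
    fun x hx => (aux_d1 δ hδ x).sqrt (aux_pos δ hδ x hx).ne'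
  have hpow : ((ξ / δ) * Real.tanh (δ * ξ)) ^ ((3 : ℝ) / 2) =
      Real.sqrt ((ξ / δ) * Real.tanh (δ * ξ)) ^ 3 := by
    rw [Real.sqrt_eq_rpow, ← Real.rpow_natCast, ← Real.rpow_mul hpos.le]
    norm_num
  refine ⟨(hD ξ hξ).differentiableAt, ?_, ?_⟩
  · have h2 := (aux_d2 δ hδ ξ).div ((hD ξ hξ).const_mul 2) (by positivity)
    have he : deriv (fun x : ℝ => Real.sqrt ((x / δ) * Real.tanh (δ * x))) =ᶠ[nhds ξ]
        (fun x => (Real.sinh (δ * x) * Real.cosh (δ * x) + δ * x) / (δ * Real.cosh (δ * x) ^ 2) /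
        (2 * Real.sqrt ((x / δ) * Real.tanh (δ * x)))) := by
      filter_upwards [isOpen_ne.mem_nhds hξ] with x hx
      exact (hD x hx).deriv
    refine HasDerivAt.congr_of_eventuallyEq ?_ he
    refine HasDerivAt.congr_deriv h2 ?_
    rw [hpow]
    have hr := Real.sq_sqrt hpos.le
    generalize Real.sqrt ((ξ / δ) * Real.tanh (δ * ξ)) = r at *
    rw [Real.tanh_eq_sinh_div_cosh] at hr
    have hr' : r ^ 2 * (δ * Real.cosh (δ * ξ)) = ξ * Real.sinh (δ * ξ) := by
      rw [hr]; field_simp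
    clear h2 he hD hpow hpos
    generalize Real.cosh (δ * ξ) = c at *
    generalize Real.sinh (δ * ξ) = s at *
    field_simp
    linear_combination (16 * δ * (c - δ * ξ * s)) * hr'
  · have hs : Real.sinh (δ * ξ) ≠ 0 := by
      rw [Ne, Real.sinh_eq_zero]; positivity
    rw [neg_mul, neg_lt_zero]
    have : 0 < ((ξ / δ) * Real.tanh (δ * ξ)) ^ ((3 : ℝ) / 2) := Real.rpow_pos_of_pos hpos _
    have : 0 < 4 * δ ^ 2 * ξ ^ 2 * Real.sinh (δ * ξ) ^ 2 := by positivity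
    positivity
end

section
/- Let δ > 0 and define τ_δ : ℝ → ℝ by τ_δ(ξ) = (ξ/δ)·tanh(δξ), and let D(ξ) denote the derivative of ξ ↦ √(τ_δ(ξ)) at ξ > 0. Then D is strictly decreasing on (0, ∞) and satisfies 0 < D(ξ) < 1 for every ξ > 0. -/
theorem aux_tanh (y : ℝ) : HasDerivAt Real.tanh (1 - Real.tanh y ^ 2) y := by
  have hc : Real.cosh y ≠ 0 := (Real.cosh_pos y).ne'
  have h := (Real.hasDerivAt_sinh y).div (Real.hasDerivAt_cosh y) hc
  have e : Real.tanh = Real.sinh / Real.cosh := by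
    funext x
    simp [Real.tanh_eq_sinh_div_cosh]
  rw [e]
  refine h.congr_deriv ?_
  simp only [Pi.div_apply]
  field_simp

theorem aux_tanh_pos {y : ℝ} (hy : 0 < y) : 0 < Real.tanh y := by
  rw [Real.tanh_eq_sinh_div_cosh]
  exact div_pos (Real.sinh_pos_iff.2 hy) (Real.cosh_pos y)

theorem aux_tanh_upper {y : ℝ} (hy : 0 < y) : Real.tanh y < y := by
  have hd : ∀ x : ℝ, HasDerivAt (fun x => x - Real.tanh x) (1 - (1 - Real.tanh x ^ 2)) x :=
    fun x => (hasDerivAt_id x).sub (aux_tanh x)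
  have hm : StrictMonoOn (fun x : ℝ => x - Real.tanh x) (Set.Ici 0) := by
    apply strictMonoOn_of_deriv_pos (convex_Ici 0)
    · intro x _
      exact (hd x).continuousAt.continuousWithinAt
    · intro x hx
      rw [interior_Ici] at hx
      rw [(hd x).deriv]
      have := pow_pos (aux_tanh_pos hx) 2
      linarith
  have := hm (Set.mem_Ici.2 le_rfl) (Set.mem_Ici.2 hy.le) hy
  simp only [Real.tanh_zero] at this
  linarith

theorem aux_tanh_lower {y : ℝ} (hy : 0 < y) : y < Real.tanh y * (1 + y) := by
  have h1 : 2 * y + 1 < Real.exp (2 * y) := Real.add_one_lt_exp (by positivity)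
  have h2 : Real.exp (2 * y) = Real.exp y * Real.exp y := by
    rw [← Real.exp_add]; ring_nf
  have h3 : Real.exp y * Real.exp (-y) = 1 := by
    rw [← Real.exp_add]; simp
  have hp := Real.exp_pos y
  have hm := Real.exp_pos (-y)
  rw [Real.tanh_eq, div_mul_eq_mul_div, lt_div_iff₀ (by positivity)]
  rw [h2] at h1
  have h4 := mul_lt_mul_of_pos_right h1 hm
  have h5 : Real.exp y * Real.exp y * Real.exp (-y) = Real.exp y := by
    rw [mul_assoc, h3, mul_one]
  rw [h5] at h4
  nlinarith

/-- the derivative of `√(y tanh y)`. -/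
noncomputable def auxG (y : ℝ) : ℝ :=
  (Real.tanh y + y * (1 - Real.tanh y ^ 2)) / (2 * Real.sqrt (y * Real.tanh y))

theorem aux_f (y : ℝ) : HasDerivAt (fun y => y * Real.tanh y)
    (Real.tanh y + y * (1 - Real.tanh y ^ 2)) y := by
  have h := (hasDerivAt_id y).mul (aux_tanh y)
  refine h.congr_deriv ?_
  simp

theorem aux_g {y : ℝ} (hy : 0 < y) :
    HasDerivAt (fun y => Real.sqrt (y * Real.tanh y)) (auxG y) y :=
  (aux_f y).sqrt (mul_pos hy (aux_tanh_pos hy)).ne'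

theorem aux_D {δ : ℝ} (hδ : 0 < δ) {ξ : ℝ} (hξ : 0 < ξ) :
    deriv (fun x : ℝ => Real.sqrt ((x / δ) * Real.tanh (δ * x))) ξ = auxG (δ * ξ) := by
  have e : (fun x : ℝ => Real.sqrt ((x / δ) * Real.tanh (δ * x))) =
      fun x => Real.sqrt ((δ * x) * Real.tanh (δ * x)) / δ := by
    funext x
    have : (x / δ) * Real.tanh (δ * x) = ((δ * x) * Real.tanh (δ * x)) / δ ^ 2 := by
      field_simp
    rw [this, Real.sqrt_div' _ (by positivity), Real.sqrt_sq hδ.le]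
  rw [e]
  have h0 : HasDerivAt (fun x : ℝ => δ * x) δ ξ := by
    simpa using (hasDerivAt_id ξ).const_mul δ
  have h1 := (aux_g (mul_pos hδ hξ)).comp ξ h0
  have h2 := (h1.div_const δ).deriv
  rw [mul_div_cancel_right₀ _ hδ.ne'] at h2
  exact h2

theorem aux_anti : StrictAntiOn auxG (Set.Ioi 0) := by
  have key : ∀ y : ℝ, 0 < y → ∃ d : ℝ, d < 0 ∧ HasDerivAt auxG d y := by
    intro y hy
    have ht := aux_tanh_pos hy
    have hs : 0 < 1 - Real.tanh y ^ 2 := sub_pos.2 (Real.tanh_sq_lt_one y)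
    have hf := mul_pos hy ht
    have hr := Real.sqrt_pos.2 hf
    have hsq := Real.sq_sqrt hf.le
    have hn := (aux_tanh y).add ((hasDerivAt_id y).mul (((aux_tanh y).pow 2).const_sub 1))
    have hd := (aux_g hy).const_mul 2
    have h := hn.div hd (by positivity)
    refine ⟨_, ?_, h⟩
    apply div_neg_of_neg_of_pos _ (by positivity)
    simp only [auxG, id, Pi.add_apply, Pi.mul_apply, Pi.pow_apply]
    generalize Real.sqrt (y * Real.tanh y) = r at *
    generalize Real.tanh y = t at *
    have e : ∀ A B : ℝ, A * (2 * r) - B * (2 * (B / (2 * r))) = (2 * r ^ 2 * A - B ^ 2) / r := by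
      intro A B
      field_simp
    simp only [Pi.pow_apply, id] at *
    rw [e]
    apply div_neg_of_neg_of_pos _ hr
    rw [hsq]
    have : 0 < y ^ 2 * t ^ 2 * (1 - t ^ 2) := by positivity
    norm_num
    nlinarith [sq_nonneg (t - y * (1 - t ^ 2))]
  apply strictAntiOn_of_deriv_neg (convex_Ioi 0)
  · intro y hy
    obtain ⟨d, _, h⟩ := key y hy
    exact h.continuousAt.continuousWithinAt
  · intro y hy
    rw [interior_Ioi] at hy
    obtain ⟨d, hd, h⟩ := key y hy
    rwa [h.deriv]

theorem aux_bounds {y : ℝ} (hy : 0 < y) : 0 < auxG y ∧ auxG y < 1 := by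
  have ht := aux_tanh_pos hy
  have ht1 := Real.tanh_lt_one y
  have hs : 0 < 1 - Real.tanh y ^ 2 := sub_pos.2 (Real.tanh_sq_lt_one y)
  have hf := mul_pos hy ht
  have hr := Real.sqrt_pos.2 hf
  have hsq := Real.sq_sqrt hf.le
  have hl := aux_tanh_lower hy
  have hu := aux_tanh_upper hy
  unfold auxG
  refine ⟨by positivity, ?_⟩
  rw [div_lt_one (by positivity)]
  generalize Real.sqrt (y * Real.tanh y) = r at *
  generalize Real.tanh y = t at *
  -- `(y - r)^2 < (y t)^2`
  by_cases hyr : y ≤ r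
  · have h1 : y * y ≤ r ^ 2 := by nlinarith
    have h2 : y ≤ t := by rw [hsq] at h1; exact le_of_mul_le_mul_left h1 hy
    exact absurd hu (not_lt.2 h2)
  · push Not at hyr
    have h2 : t < r := by
      by_contra hh
      push Not at hh
      nlinarith
    have h4 : (y - r) < y * t := by nlinarith
    have h5 : (y - r) ^ 2 < (y * t) ^ 2 := by
      apply pow_lt_pow_left₀ h4 (by linarith) (by norm_num)
    have : y * (t + y * (1 - t ^ 2)) < y * (2 * r) := by nlinarith
    exact lt_of_mul_lt_mul_left this hy.le

theorem deriv_sqrt_tau_strictAntiOn (δ : ℝ) (hδ : 0 < δ) :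
    StrictAntiOn (deriv (fun x : ℝ => Real.sqrt ((x / δ) * Real.tanh (δ * x))))
      (Set.Ioi 0) ∧
    ∀ ξ : ℝ, 0 < ξ →
      0 < deriv (fun x : ℝ => Real.sqrt ((x / δ) * Real.tanh (δ * x))) ξ ∧
      deriv (fun x : ℝ => Real.sqrt ((x / δ) * Real.tanh (δ * x))) ξ < 1 := by
  constructor
  · intro a ha b hb hab
    rw [Set.mem_Ioi] at ha hb
    rw [aux_D hδ ha, aux_D hδ hb]
    exact aux_anti (mul_pos hδ ha) (mul_pos hδ hb) (mul_lt_mul_of_pos_left hab hδ)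
  · intro ξ hξ
    rw [aux_D hδ hξ]
    exact aux_bounds (mul_pos hδ hξ)
end

section
/- Let δ > 0, ξ ≠ 0, ω, α, β be real numbers, set C = α + β and Q = Cξ + ω, and let h̃ ∈ ℂ. Suppose Q ≠ 0 and δQ²·cosh(δξ) − (ξ + αQ)·sinh(δξ) ≠ 0. If D₁, D₂ ∈ ℂ satisfy the linear system ξ·(D₁ + D₂) = −(ω + βξ)·h̃ and (ξ + αQ)·(D₁e^{δξ} + D₂e^{−δξ}) = δQ²·(D₁e^{δξ} − D₂e^{−δξ}), then −(ξ/Q)·(D₁e^{δξ} + D₂e^{−δξ}) = δ·Q·(ω + βξ)·h̃ / ( δQ²·cosh(δξ) − (ξ + αQ)·sinh(δξ) ). -/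
/-- With `C = α + β`, `Q = Cξ + ω`, if `D₁, D₂ ∈ ℂ` solve the linear system
`ξ(D₁+D₂) = −(ω+βξ)h̃` and `(ξ+αQ)(D₁e^{δξ}+D₂e^{−δξ}) = δQ²(D₁e^{δξ}−D₂e^{−δξ})`,
and `Q ≠ 0`, `δQ²cosh(δξ) − (ξ+αQ)sinh(δξ) ≠ 0`, then
`−(ξ/Q)(D₁e^{δξ}+D₂e^{−δξ}) = δQ(ω+βξ)h̃ / (δQ²cosh(δξ) − (ξ+αQ)sinh(δξ))`. -/
theorem fourier_transform_of_surface_elevation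
    (δ ξ ω α β C Q : ℝ) (hδ : 0 < δ) (hξ : ξ ≠ 0)
    (hC : C = α + β) (hQdef : Q = C * ξ + ω) (h : ℂ)
    (hQ : Q ≠ 0)
    (hden : δ * Q ^ 2 * Real.cosh (δ * ξ) - (ξ + α * Q) * Real.sinh (δ * ξ) ≠ 0)
    (D₁ D₂ : ℂ)
    (h1 : (ξ : ℂ) * (D₁ + D₂) = -(((ω + β * ξ : ℝ)) : ℂ) * h)
    (h2 : (((ξ + α * Q : ℝ)) : ℂ) *
        (D₁ * ((Real.exp (δ * ξ) : ℝ) : ℂ) + D₂ * ((Real.exp (-(δ * ξ)) : ℝ) : ℂ)) =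
      (((δ * Q ^ 2 : ℝ)) : ℂ) *
        (D₁ * ((Real.exp (δ * ξ) : ℝ) : ℂ) - D₂ * ((Real.exp (-(δ * ξ)) : ℝ) : ℂ))) :
    -((ξ : ℂ) / (Q : ℂ)) *
        (D₁ * ((Real.exp (δ * ξ) : ℝ) : ℂ) + D₂ * ((Real.exp (-(δ * ξ)) : ℝ) : ℂ)) =
      (((δ * Q * (ω + β * ξ) : ℝ)) : ℂ) * h /
        (((δ * Q ^ 2 * Real.cosh (δ * ξ) - (ξ + α * Q) * Real.sinh (δ * ξ) : ℝ)) : ℂ) := by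
  have hEF : ((Real.exp (δ * ξ) : ℝ) : ℂ) * ((Real.exp (-(δ * ξ)) : ℝ) : ℂ) = 1 := by
    rw [← Complex.ofReal_mul, ← Real.exp_add]; simp
  have hdenC := Complex.ofReal_ne_zero.mpr hden
  have hQC := Complex.ofReal_ne_zero.mpr hQ
  rw [eq_div_iff hdenC]
  rw [Real.cosh_eq, Real.sinh_eq]
  generalize Real.exp (δ * ξ) = E at *
  generalize Real.exp (-(δ * ξ)) = F at *
  clear hdenC hden hQdef hC
  push_cast at *
  have key : ((δ : ℂ) * Q ^ 2 * ((E + F) / 2) - (ξ + α * Q) * ((E - F) / 2)) * (D₁ * E + D₂ * F)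
      = δ * Q ^ 2 * (D₁ + D₂) := by
    linear_combination (-((E : ℂ) - F) / 2) * h2 + (δ : ℂ) * Q ^ 2 * (D₁ + D₂) * hEF
  field_simp
  field_simp at key
  linear_combination (-(ξ : ℂ)) * key - 2 * δ * Q ^ 2 * h1
end

section
/- Let C ∈ ℝ and let g : ℝ² → ℝ be a smooth function (of the variables (r, s)) all of whose derivatives are bounded. Define f(x, t) = (1/2) ∫₀ᵗ ∫_{x−(t−s)(C+1)}^{x−(t−s)(C−1)} g(r, s) dr ds. Then f(x, 0) = 0 and ∂_t f(x, 0) = 0 for all x, and f satisfies (C·∂_x + ∂_t)² f(x,t) − ∂_x² f(x,t) = g(x,t) for all (x, t) ∈ ℝ². -/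
open MeasureTheory intervalIntegral

lemma duh_param {φ φ' : ℝ → ℝ → ℝ} (hφ : Continuous (Function.uncurry φ))
    (hφ' : Continuous (Function.uncurry φ'))
    (hd : ∀ y s, HasDerivAt (fun y => φ y s) (φ' y s) y) (a b y₀ : ℝ) :
    HasDerivAt (fun y => ∫ s in a..b, φ y s) (∫ s in a..b, φ' y₀ s) y₀ := by
  have hc : ∀ y, Continuous (φ y) := fun y => hφ.comp (Continuous.prodMk_right y)
  have hc' : ∀ y, Continuous (φ' y) := fun y => hφ'.comp (Continuous.prodMk_right y)
  obtain ⟨M, hM⟩ := ((isCompact_closedBall y₀ 1).prod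
    (isCompact_uIcc (a := a) (b := b))).exists_bound_of_continuousOn hφ'.continuousOn
  refine (intervalIntegral.hasDerivAt_integral_of_dominated_loc_of_deriv_le
    (F := φ) (F' := φ') (bound := fun _ => M)
    (Metric.closedBall_mem_nhds y₀ one_pos) ?_ ?_ ?_ ?_ ?_ ?_).2
  · exact Filter.Eventually.of_forall fun y => (hc y).aestronglyMeasurable
  · exact (hc y₀).intervalIntegrable _ _
  · exact (hc' y₀).aestronglyMeasurable
  · exact Filter.Eventually.of_forall fun t ht y hy =>
      hM (y, t) ⟨hy, Set.uIoc_subset_uIcc ht⟩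
  · exact intervalIntegrable_const
  · exact Filter.Eventually.of_forall fun t _ y _ => hd y t

lemma duh_leibniz {φ φ' : ℝ → ℝ → ℝ} (hφ : Continuous (Function.uncurry φ))
    (hφ' : Continuous (Function.uncurry φ'))
    (hd : ∀ y s, HasDerivAt (fun y => φ y s) (φ' y s) y) (t : ℝ) :
    HasDerivAt (fun t => ∫ s in (0:ℝ)..t, φ t s) (φ t t + ∫ s in (0:ℝ)..t, φ' t s) t := by
  have hc : ∀ y, Continuous (φ y) := fun y => hφ.comp (Continuous.prodMk_right y)
  have key := hasStrictFDerivAt_uncurry_coprod (𝕜 := ℝ) (u := (t, t))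
    (f := fun y u => ∫ s in (0:ℝ)..u, φ y s)
    (f₁ := fun y u => ContinuousLinearMap.toSpanSingleton ℝ (∫ s in (0:ℝ)..u, φ' y s))
    (f₂ := fun y u => ContinuousLinearMap.toSpanSingleton ℝ (φ y u))
    (Filter.Eventually.of_forall fun v => (duh_param hφ hφ' hd 0 v.2 v.1).hasFDerivAt)
    (Filter.Eventually.of_forall fun v =>
      ((hc v.1).integral_hasStrictDerivAt 0 v.2).hasDerivAt.hasFDerivAt)
    (by
      apply Continuous.continuousAt
      have := intervalIntegral.continuous_parametric_primitive_of_continuous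
        (μ := volume) (a₀ := 0) hφ'
      exact (ContinuousLinearMap.toSpanSingletonCLE (𝕜 := ℝ) (E := ℝ)).continuous.comp this)
    (by
      apply Continuous.continuousAt
      exact (ContinuousLinearMap.toSpanSingletonCLE (𝕜 := ℝ) (E := ℝ)).continuous.comp hφ)
  have h2 : HasDerivAt (fun t : ℝ => (t, t)) ((1:ℝ), (1:ℝ)) t :=
    (hasDerivAt_id t).prodMk (hasDerivAt_id t)
  have h3 := HasFDerivAt.comp_hasDerivAt (f := fun t : ℝ => (t, t)) t key.hasFDerivAt h2
  have h4 : φ t t + ∫ s in (0:ℝ)..t, φ' t s =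
      ((ContinuousLinearMap.toSpanSingleton ℝ (∫ s in (0:ℝ)..t, φ' t s)).coprod
        (ContinuousLinearMap.toSpanSingleton ℝ (φ t t))) ((1:ℝ), (1:ℝ)) := by
    simp [add_comm]
  rw [h4]
  exact h3

/-- The characteristic integral. -/
noncomputable def duhI (c : ℝ) (h : ℝ → ℝ → ℝ) (x t : ℝ) : ℝ :=
  ∫ s in (0:ℝ)..t, h (x - (t - s) * c) s

lemma duhI_x {h h' : ℝ → ℝ → ℝ} (hh : Continuous (Function.uncurry h))
    (hh' : Continuous (Function.uncurry h'))
    (hd : ∀ y s, HasDerivAt (fun y => h y s) (h' y s) y) (c x t : ℝ) :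
    HasDerivAt (fun x => duhI c h x t) (duhI c h' x t) x := by
  unfold duhI
  refine duh_param (φ := fun x s => h (x - (t - s) * c) s)
    (φ' := fun x s => h' (x - (t - s) * c) s) ?_ ?_ ?_ 0 t x
  · exact hh.comp (f := fun p : ℝ × ℝ => (p.1 - (t - p.2) * c, p.2)) (by fun_prop)
  · exact hh'.comp (f := fun p : ℝ × ℝ => (p.1 - (t - p.2) * c, p.2)) (by fun_prop)
  · intro y s
    exact (hd (y - (t - s) * c) s).comp_sub_const y ((t - s) * c)

lemma duhI_t {h h' : ℝ → ℝ → ℝ} (hh : Continuous (Function.uncurry h))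
    (hh' : Continuous (Function.uncurry h'))
    (hd : ∀ y s, HasDerivAt (fun y => h y s) (h' y s) y) (c x t : ℝ) :
    HasDerivAt (fun t => duhI c h x t) (h x t - c * duhI c h' x t) t := by
  unfold duhI
  have := duh_leibniz (φ := fun t s => h (x - (t - s) * c) s)
    (φ' := fun t s => -c * h' (x - (t - s) * c) s) ?_ ?_ ?_ t
  · convert this using 1
    simp [sub_eq_add_neg]
  · exact hh.comp (f := fun p : ℝ × ℝ => (x - (p.1 - p.2) * c, p.2)) (by fun_prop)
  · exact continuous_const.mul
      (hh'.comp (f := fun p : ℝ × ℝ => (x - (p.1 - p.2) * c, p.2)) (by fun_prop))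
  · intro y s
    have h1 : HasDerivAt (fun y => x - (y - s) * c) (-c) y := by
      simpa using (((hasDerivAt_id y).sub_const s).mul_const c).const_sub x
    have := (hd (x - (y - s) * c) s).comp y h1
    rw [mul_comm]
    exact this

/-- Duhamel's formula for the shallow-water equation: with `S = C∂_x + ∂_t` and
`f(x,t) = (1/2)∫₀ᵗ ∫_{x−(t−s)(C+1)}^{x−(t−s)(C−1)} g(r,s) dr ds` for a smooth `g`
with bounded derivatives, one has `f(x,0) = 0`, `∂_t f(x,0) = 0` and
`S²f − ∂_x²f = g` everywhere. -/
theorem duhamel_shallow_water (C : ℝ) (g : ℝ × ℝ → ℝ)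
    (hg : ContDiff ℝ (⊤ : ℕ∞) g)
    (hbd : ∀ n : ℕ, ∃ M : ℝ, ∀ p : ℝ × ℝ, ‖iteratedFDeriv ℝ n g p‖ ≤ M)
    (f : ℝ → ℝ → ℝ)
    (hf : ∀ x t : ℝ, f x t =
      (1 / 2) * ∫ s in (0:ℝ)..t,
        ∫ r in (x - (t - s) * (C + 1))..(x - (t - s) * (C - 1)), g (r, s)) :
    (∀ x : ℝ, f x 0 = 0) ∧
    (∀ x : ℝ, deriv (fun t => f x t) 0 = 0) ∧
    (∀ x t : ℝ,
      C ^ 2 * deriv (fun x' => deriv (fun x'' => f x'' t) x') x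
        + 2 * C * deriv (fun t' => deriv (fun x' => f x' t') x) t
        + deriv (fun t' => deriv (fun t'' => f x t'') t') t
        - deriv (fun x' => deriv (fun x'' => f x'' t) x') x = g (x, t)) := by
  set G : ℝ → ℝ → ℝ := fun y s => ∫ r in (0:ℝ)..y, g (r, s) with hG
  set k : ℝ → ℝ → ℝ := fun y s => g (y, s) with hk
  set k' : ℝ → ℝ → ℝ := fun y s => fderiv ℝ g (y, s) (1, 0) with hk'
  have gc : Continuous g := hg.continuous
  have kc : Continuous (Function.uncurry k) := gc
  have kc' : Continuous (Function.uncurry k') :=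
    (hg.continuous_fderiv (by simp)).clm_apply continuous_const
  have Gc : Continuous (Function.uncurry G) := by
    have h0 := intervalIntegral.continuous_parametric_primitive_of_continuous
      (μ := volume) (a₀ := 0) (f := fun s r : ℝ => g (r, s)) (gc.comp continuous_swap)
    exact h0.comp continuous_swap
  have gr : ∀ s, Continuous fun r => g (r, s) := fun s => by fun_prop
  have Gd : ∀ y s, HasDerivAt (fun y => G y s) (k y s) y := fun y s =>
    ((gr s).integral_hasStrictDerivAt 0 y).hasDerivAt
  have kd : ∀ y s, HasDerivAt (fun y => k y s) (k' y s) y := fun y s => by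
    have h1 : HasFDerivAt g (fderiv ℝ g (y, s)) (y, s) :=
      (hg.differentiable (by simp) (y, s)).hasFDerivAt
    exact h1.comp_hasDerivAt y ((hasDerivAt_id y).prodMk (hasDerivAt_const y s))
  have hfI : ∀ x t, f x t = 1 / 2 * (duhI (C - 1) G x t - duhI (C + 1) G x t) := by
    intro x t
    rw [hf, duhI, duhI, ← intervalIntegral.integral_sub]
    · congr 1
      apply intervalIntegral.integral_congr
      intro s _
      exact (intervalIntegral.integral_interval_sub_left ((gr s).intervalIntegrable _ _)
        ((gr s).intervalIntegrable _ _)).symm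
    · exact (Gc.comp (f := fun s : ℝ => (x - (t - s) * (C - 1), s))
        (by fun_prop)).intervalIntegrable _ _
    · exact (Gc.comp (f := fun s : ℝ => (x - (t - s) * (C + 1), s))
        (by fun_prop)).intervalIntegrable _ _
  have fx : ∀ x t, deriv (fun x => f x t) x
      = 1 / 2 * (duhI (C - 1) k x t - duhI (C + 1) k x t) := by
    intro x t
    simp only [hfI]
    exact (((duhI_x Gc kc Gd _ x t).fun_sub (duhI_x Gc kc Gd _ x t)).const_mul _).deriv
  have ft : ∀ x t, deriv (fun t => f x t) t
      = 1 / 2 * ((C + 1) * duhI (C + 1) k x t - (C - 1) * duhI (C - 1) k x t) := by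
    intro x t
    simp only [hfI]
    rw [(((duhI_t Gc kc Gd _ x t).fun_sub (duhI_t Gc kc Gd _ x t)).const_mul _).deriv]
    ring
  refine ⟨fun x => by simp [hf], fun x => by rw [ft]; simp [duhI], fun x t => ?_⟩
  simp only [fx, ft]
  rw [(((duhI_x kc kc' kd _ x t).fun_sub (duhI_x kc kc' kd _ x t)).const_mul _).deriv,
    (((duhI_t kc kc' kd _ x t).fun_sub (duhI_t kc kc' kd _ x t)).const_mul _).deriv,
    ((((duhI_t kc kc' kd _ x t).const_mul _).fun_sub
      ((duhI_t kc kc' kd _ x t).const_mul _)).const_mul _).deriv]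
  simp only [hk]
  ring
end

section
/- Let C ∈ ℝ, let a ∈ C²(ℝ, ℝ) satisfy a(t) = 0 for all t ≤ 0, and let b ∈ C²(ℝ, ℝ) have compact support. Then for all x ∈ ℝ and t ≥ 0: (1/2) ∫₀ᵗ ∫_{x−(t−s)(C+1)}^{x−(t−s)(C−1)} [ a''(s)·b(r) + 2C·a'(s)·b'(r) + C²·a(s)·b''(r) ] dr ds = a(t)·b(x) + (1/2) ∫₀ᵗ a(s)·[ b'(x − (t−s)(C−1)) − b'(x − (t−s)(C+1)) ] ds. -/
open MeasureTheory intervalIntegral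

/-- With `h(x,t) = a(t)b(x)`, `a ∈ C²` vanishing on `t ≤ 0`, and `b ∈ C²` compactly
supported, Duhamel's formula simplifies: for `t ≥ 0`,
`(1/2)∫₀ᵗ∫_{x−(t−s)(C+1)}^{x−(t−s)(C−1)} [a''(s)b(r) + 2C a'(s)b'(r) + C² a(s)b''(r)] dr ds
 = a(t)b(x) + (1/2)∫₀ᵗ a(s)[b'(x−(t−s)(C−1)) − b'(x−(t−s)(C+1))] ds`. -/
theorem duhamel_separated_bed_motion (C : ℝ) (a b : ℝ → ℝ)
    (ha : ContDiff ℝ 2 a) (hb : ContDiff ℝ 2 b)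
    (ha0 : ∀ t : ℝ, t ≤ 0 → a t = 0) (hbsupp : HasCompactSupport b)
    (x t : ℝ) (ht : 0 ≤ t) :
    (1 / 2) * (∫ s in (0:ℝ)..t,
        ∫ r in (x - (t - s) * (C + 1))..(x - (t - s) * (C - 1)),
          (deriv (deriv a) s * b r + 2 * C * deriv a s * deriv b r +
            C ^ 2 * a s * deriv (deriv b) r)) =
      a t * b x + (1 / 2) * ∫ s in (0:ℝ)..t,
        a s * (deriv b (x - (t - s) * (C - 1)) - deriv b (x - (t - s) * (C + 1))) := by
  have had : Differentiable ℝ a := ha.differentiable (by norm_num)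
  have hbd : Differentiable ℝ b := hb.differentiable (by norm_num)
  have ha1 : ContDiff ℝ 1 (deriv a) := by
    have h2 : ContDiff ℝ (1 + 1) a := by simpa [one_add_one_eq_two] using ha
    exact (contDiff_succ_iff_deriv.1 h2).2.2
  have hb1 : ContDiff ℝ 1 (deriv b) := by
    have h2 : ContDiff ℝ (1 + 1) b := by simpa [one_add_one_eq_two] using hb
    exact (contDiff_succ_iff_deriv.1 h2).2.2
  have ha1d : Differentiable ℝ (deriv a) := ha1.differentiable (by norm_num)
  have hb1d : Differentiable ℝ (deriv b) := hb1.differentiable (by norm_num)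
  have ha2c : Continuous (deriv (deriv a)) := ha1.continuous_deriv (by norm_num)
  have hb2c : Continuous (deriv (deriv b)) := hb1.continuous_deriv (by norm_num)
  have hac := had.continuous
  have hbc := hbd.continuous
  have ha1c := ha1d.continuous
  have hb1c := hb1d.continuous
  have hda0 : deriv a 0 = 0 := by
    have h1 : HasDerivWithinAt a (deriv a 0) (Set.Iic 0) 0 := (had 0).hasDerivAt.hasDerivWithinAt
    have h2 : HasDerivWithinAt a 0 (Set.Iic 0) 0 :=
      (hasDerivWithinAt_const (0:ℝ) (Set.Iic 0) (0:ℝ)).congr (fun y hy => ha0 y hy) (ha0 0 le_rfl)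
    exact (uniqueDiffOn_Iic (0:ℝ) 0 (by simp)).eq_deriv _ h1 h2
  obtain ⟨B, hB⟩ : ∃ B : ℝ → ℝ, ∀ y, HasDerivAt B (b y) y :=
    ⟨fun y => ∫ r in (0:ℝ)..y, b r, fun y => hbc.integral_hasStrictDerivAt 0 y |>.hasDerivAt⟩
  have hBc : Continuous B := continuous_iff_continuousAt.2 fun y => (hB y).continuousAt
  have hinner : ∀ s u v : ℝ, (∫ r in u..v, (deriv (deriv a) s * b r + 2 * C * deriv a s * deriv b r +
            C ^ 2 * a s * deriv (deriv b) r)) =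
      deriv (deriv a) s * (B v - B u) + 2 * C * deriv a s * (b v - b u)
        + C ^ 2 * a s * (deriv b v - deriv b u) := by
    intro s u v
    rw [integral_eq_sub_of_hasDerivAt (f := fun r => deriv (deriv a) s * B r
      + 2 * C * deriv a s * b r + C ^ 2 * a s * deriv b r)]
    · ring
    · intro r _
      exact (((hB r).const_mul _).add ((hbd r).hasDerivAt.const_mul _)).add
        ((hb1d r).hasDerivAt.const_mul _)
    · exact Continuous.intervalIntegrable (by fun_prop) _ _
  simp only [hinner]
  have hlin : ∀ k s : ℝ, HasDerivAt (fun s => x - (t - s) * k) k s := by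
    intro k s
    have := (((hasDerivAt_id s).const_sub t).mul_const k).const_sub x
    simpa using this
  have hcomp : ∀ (f f' : ℝ → ℝ), (∀ y, HasDerivAt f (f' y) y) → ∀ k s : ℝ,
      HasDerivAt (fun s => f (x - (t - s) * k)) (f' (x - (t - s) * k) * k) s :=
    fun f f' hf k s => (hf (x - (t - s) * k)).comp s (hlin k s)
  have hbD : ∀ y, HasDerivAt b (deriv b y) y := fun y => (hbd y).hasDerivAt
  have key := integral_eq_sub_of_hasDerivAt (a := 0) (b := t)
    (f := fun s => deriv a s * (B (x - (t - s) * (C - 1)) - B (x - (t - s) * (C + 1)))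
      + a s * ((C + 1) * b (x - (t - s) * (C - 1)) - (C - 1) * b (x - (t - s) * (C + 1))))
    (f' := fun s => (deriv (deriv a) s * (B (x - (t - s) * (C - 1)) - B (x - (t - s) * (C + 1)))
        + 2 * C * deriv a s * (b (x - (t - s) * (C - 1)) - b (x - (t - s) * (C + 1)))
        + C ^ 2 * a s * (deriv b (x - (t - s) * (C - 1)) - deriv b (x - (t - s) * (C + 1))))
        - a s * (deriv b (x - (t - s) * (C - 1)) - deriv b (x - (t - s) * (C + 1))))
    (by
      intro s _
      have h := ((ha1d s).hasDerivAt.mul ((hcomp B b hB (C - 1) s).sub (hcomp B b hB (C + 1) s))).add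
        ((had s).hasDerivAt.mul (((hcomp b _ hbD (C - 1) s).const_mul (C + 1)).sub
          ((hcomp b _ hbD (C + 1) s).const_mul (C - 1))))
      refine h.congr_deriv ?_
      simp only [Pi.sub_apply]
      ring)
    (Continuous.intervalIntegrable (by fun_prop) _ _)
  rw [integral_sub (Continuous.intervalIntegrable (by fun_prop) _ _)
    (Continuous.intervalIntegrable (by fun_prop) _ _)] at key
  simp only [hda0, ha0 0 le_rfl, sub_self, zero_mul, sub_zero, mul_zero, zero_add, add_zero] at key
  linarith
end

section
/- Let C ∈ ℝ with C² ≠ 1 and let b ∈ C²(ℝ, ℝ). Define for t > 0: f(x, t) = (C²/(C²−1))·b(x) + b(x − t(1+C))/(2(1+C)) + b(x + t(1−C))/(2(1−C)). Then f is twice differentiable in (x,t) for t > 0 and satisfies (C·∂_x + ∂_t)² f(x,t) − ∂_x² f(x,t) = C²·b''(x) for all x ∈ ℝ and t > 0. -/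
theorem tw_hx (g : ℝ → ℝ) (hg : Differentiable ℝ g) (A B D p q t x : ℝ) :
    HasDerivAt (fun x => A * g x + B * g (x - t * p) + D * g (x + t * q))
      (A * deriv g x + B * deriv g (x - t * p) + D * deriv g (x + t * q)) x := by
  have h1 := (hg x).hasDerivAt.const_mul A
  have h2 := ((hg (x - t * p)).hasDerivAt.comp_sub_const x (t * p)).const_mul B
  have h3 := ((hg (x + t * q)).hasDerivAt.comp_add_const x (t * q)).const_mul D
  exact (h1.add h2).add h3

theorem tw_ht (g : ℝ → ℝ) (hg : Differentiable ℝ g) (K B D p q x t : ℝ) :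
    HasDerivAt (fun t => K + B * g (x - t * p) + D * g (x + t * q))
      (0 + (B * -p) * deriv g (x - t * p) + (D * q) * deriv g (x + t * q)) t := by
  have e2 : HasDerivAt (fun t : ℝ => x - t * p) (-p) t := by
    simpa using ((hasDerivAt_id t).mul_const p).const_sub x
  have e3 : HasDerivAt (fun t : ℝ => x + t * q) q t := by
    simpa using ((hasDerivAt_id t).mul_const q).const_add x
  have h2 := ((hg (x - t * p)).hasDerivAt.comp t e2).const_mul B
  have h3 := ((hg (x + t * q)).hasDerivAt.comp t e3).const_mul D
  refine (((hasDerivAt_const t K).add h2).add h3).congr_deriv ?_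
  ring

/-- For `C² ≠ 1` and `b ∈ C²`, the free surface
`f(x,t) = (C²/(C²−1))b(x) + b(x−t(1+C))/(2(1+C)) + b(x+t(1−C))/(2(1−C))`
is twice differentiable in `(x,t)` for `t > 0` and satisfies
`(C∂_x + ∂_t)² f − ∂_x² f = C² b''(x)` for all `x` and `t > 0`. -/
theorem travelling_wave_solution (C : ℝ) (hC : C ^ 2 ≠ 1) (b : ℝ → ℝ)
    (hb : ContDiff ℝ 2 b) (f : ℝ → ℝ → ℝ)
    (hf : ∀ x t : ℝ, f x t = (C ^ 2 / (C ^ 2 - 1)) * b x +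
        b (x - t * (1 + C)) / (2 * (1 + C)) + b (x + t * (1 - C)) / (2 * (1 - C))) :
    ContDiffOn ℝ 2 (fun p : ℝ × ℝ => f p.1 p.2) {p : ℝ × ℝ | 0 < p.2} ∧
    ∀ x t : ℝ, 0 < t →
      C ^ 2 * deriv (fun x' => deriv (fun x'' => f x'' t) x') x
        + 2 * C * deriv (fun t' => deriv (fun x' => f x' t') x) t
        + deriv (fun t' => deriv (fun t'' => f x t'') t') t
        - deriv (fun x' => deriv (fun x'' => f x'' t) x') x
      = C ^ 2 * deriv (deriv b) x := by
  have h1 : 1 + C ≠ 0 := fun h => hC (by nlinarith)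
  have h2 : 1 - C ≠ 0 := fun h => hC (by nlinarith)
  have h3 : C ^ 2 - 1 ≠ 0 := sub_ne_zero.mpr hC
  have hb1 : Differentiable ℝ b := hb.differentiable (by norm_num)
  have hb2 : Differentiable ℝ (deriv b) := by
    have h : ContDiff ℝ 1 (deriv b) :=
      ((contDiff_succ_iff_deriv (n := 1)).1 (by simpa [one_add_one_eq_two] using hb)).2.2
    exact h.differentiable (by norm_num)
  obtain rfl : f = fun x t => (C ^ 2 / (C ^ 2 - 1)) * b x +
      (1 / (2 * (1 + C))) * b (x - t * (1 + C)) + (1 / (2 * (1 - C))) * b (x + t * (1 - C)) := by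
    funext x t
    rw [hf]
    ring
  clear hf
  constructor
  · apply ContDiff.contDiffOn
    fun_prop
  · intro x t _
    simp only [(tw_hx b hb1 _ _ _ _ _ _ _).deriv, (tw_ht b hb1 _ _ _ _ _ _ _).deriv,
      (tw_hx (deriv b) hb2 _ _ _ _ _ _ _).deriv, (tw_ht (deriv b) hb2 _ _ _ _ _ _ _).deriv]
    field_simp
    ring
end
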